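/- arXiv:1511.01175 — 2 statements merged into one kernel-verified Lean document; each statement's English description precedes it below -/
import Mathlib

section
/- Let n, d be positive integers with dn even and fix a constant γ > 0. For every i with 1 ≤ i ≤ i1 and every pairing P ∈ S_i, the number of type I switchings on P satisfies f_I(P) ≤ 4·i·(M1 − 4i)². -/
/-!
Formalization of the pairing model of random `d`-regular (multi)graphs and of the
switchings used in the uniform sampler *REG* of Gao and Wormald,
"Uniform generation of random regular graphs".

Bins are elements of `Fin n`; each bin contains `d` points, so points are
elements of `Fin n × Fin d`.  A pairing is a perfect matching of the points,
modelled as a fixed-point-free involution on the points: the pairs of the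
pairing are the orbits `{x, P.f x}`.
-/

namespace Reg

abbrev Point (n d : ℕ) := Fin n × Fin d

/-- A pairing: a perfect matching of the `d * n` points, encoded as a
fixed-point-free involution.  The pairs are the 2-element sets `{x, f x}`. -/
structure Pairing (n d : ℕ) where
  f : Point n d → Point n d
  invol : ∀ x, f (f x) = x
  nofix : ∀ x, f x ≠ x

instance {n d : ℕ} : Finite (Pairing n d) :=
  Finite.of_injective (fun P => P.f) fun P Q h => by
    cases P; cases Q; congr

variable {n d : ℕ}

/-- The number of pairs of `P` with one point in bin `u` and one point in bin `v`
(for distinct bins `u ≠ v` this is the multiplicity of the edge `uv`). -/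
def mult (P : Pairing n d) (u v : Fin n) : ℕ :=
  (Finset.univ.filter fun a : Point n d => a.1 = u ∧ (P.f a).1 = v).card

/-- Two bins are adjacent if some pair of the pairing joins them. -/
def Adj (P : Pairing n d) (u v : Fin n) : Prop := u ≠ v ∧ 1 ≤ mult P u v

/-- The number of loops of `P` (pairs whose two points lie in the same bin). -/
def numLoops (P : Pairing n d) : ℕ :=
  (Finset.univ.filter fun a : Point n d => (P.f a).1 = a.1).card / 2

/-- The number of loops of `P` lying in bin `u`. -/
def loopsAt (P : Pairing n d) (u : Fin n) : ℕ :=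
  (Finset.univ.filter fun a : Point n d => a.1 = u ∧ (P.f a).1 = u).card / 2

/-- The number of (unordered) pairs of distinct bins joined by exactly `k` pairs of `P`,
i.e. the number of edges of multiplicity exactly `k`. -/
def edgesWithMult (P : Pairing n d) (k : ℕ) : ℕ :=
  (Finset.univ.filter fun q : Fin n × Fin n => q.1 < q.2 ∧ mult P q.1 q.2 = k).card

/-- `M1 = dn` as a real number. -/
noncomputable def M1R (n d : ℕ) : ℝ := (d : ℝ) * n

/-- `M2 = n d (d-1)` as a real number. -/
noncomputable def M2R (n d : ℕ) : ℝ := (n : ℝ) * d * ((d : ℝ) - 1)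

/-- `M3 = n d (d-1) (d-2)` as a real number. -/
noncomputable def M3R (n d : ℕ) : ℝ := (n : ℝ) * d * ((d : ℝ) - 1) * ((d : ℝ) - 2)

/-- `i1 = ⌊(1+γ)(d-1)²/4⌋`. -/
noncomputable def i1Nat (d : ℕ) (γ : ℝ) : ℕ := (⌊(1 + γ) * ((d : ℝ) - 1) ^ 2 / 4⌋).toNat

/-- The stratum `S_i` of the double-edge reduction phase: pairings with no loops,
every edge of multiplicity at most 2, and exactly `i` double edges. -/
def SD (n d i : ℕ) : Set (Pairing n d) :=
  {P | numLoops P = 0 ∧ (∀ u v : Fin n, u ≠ v → mult P u v ≤ 2) ∧ edgesWithMult P 2 = i}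

/-- `Φ1 = ⋃_{0 ≤ i ≤ m} S_i`. -/
def Phi1 (n d m : ℕ) : Set (Pairing n d) := {P | ∃ i ≤ m, P ∈ SD n d i}

/-- The labelled data (points 1–8) of a d-switching. -/
structure DSwitch (n d : ℕ) where
  p1 : Point n d
  p2 : Point n d
  p3 : Point n d
  p4 : Point n d
  p5 : Point n d
  p6 : Point n d
  p7 : Point n d
  p8 : Point n d

/-- The four target bin-pairs `u1u2, u1u3, v1v2, v1v3` of a d-switching. -/
def targets (s : DSwitch n d) : List (Fin n × Fin n) :=
  [(s.p1.1, s.p5.1), (s.p1.1, s.p7.1), (s.p2.1, s.p6.1), (s.p2.1, s.p8.1)]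

/-- `s` is a valid d-switching on `P`. -/
def IsDSwitch (P : Pairing n d) (s : DSwitch n d) : Prop :=
  P.f s.p1 = s.p2 ∧ P.f s.p3 = s.p4 ∧ P.f s.p5 = s.p6 ∧ P.f s.p7 = s.p8 ∧
  s.p1.1 = s.p3.1 ∧ s.p2.1 = s.p4.1 ∧ s.p1 ≠ s.p3 ∧
  mult P s.p1.1 s.p2.1 = 2 ∧ mult P s.p5.1 s.p6.1 = 1 ∧ mult P s.p7.1 s.p8.1 = 1 ∧
  [s.p1.1, s.p2.1, s.p5.1, s.p6.1, s.p7.1, s.p8.1].Pairwise (· ≠ ·)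

/-- The number of target bin-pairs of `s` joined by at least one pair of `P`. -/
def joinedCount (P : Pairing n d) (s : DSwitch n d) : ℕ :=
  (targets s).countP fun t => decide (1 ≤ mult P t.1 t.2)

/-- A type I switching: a d-switching creating at most one new double edge. -/
def IsTypeI (P : Pairing n d) (s : DSwitch n d) : Prop :=
  IsDSwitch P s ∧ (∀ t ∈ targets s, mult P t.1 t.2 ≤ 1) ∧ joinedCount P s ≤ 1

/-- A type I switching of class A: it creates no new double edge. -/
def IsTypeIA (P : Pairing n d) (s : DSwitch n d) : Prop := IsTypeI P s ∧ joinedCount P s = 0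

/-- A type I switching of class B: it creates exactly one new double edge. -/
def IsTypeIB (P : Pairing n d) (s : DSwitch n d) : Prop := IsTypeI P s ∧ joinedCount P s = 1

/-- The labelled data (points 1–12) of a type II switching. -/
structure DSwitch2 (n d : ℕ) extends DSwitch n d where
  p9 : Point n d
  p10 : Point n d
  p11 : Point n d
  p12 : Point n d

/-- A type II switching: a d-switching creating exactly two new double edges, both
incident with `u1` or both incident with `v1`, together with the labelling
`{9,10}, {11,12}` (with 9 and 12 in `u1`, resp. `v1`) of the two existing pairs
joining the two joined target bin-pairs. -/
def IsTypeII (P : Pairing n d) (s : DSwitch2 n d) : Prop :=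
  IsDSwitch P s.toDSwitch ∧ (∀ t ∈ targets s.toDSwitch, mult P t.1 t.2 ≤ 1) ∧
  P.f s.p9 = s.p10 ∧ P.f s.p11 = s.p12 ∧
  ((s.p9.1 = s.p1.1 ∧ s.p12.1 = s.p1.1 ∧
      ((s.p10.1 = s.p5.1 ∧ s.p11.1 = s.p7.1) ∨ (s.p10.1 = s.p7.1 ∧ s.p11.1 = s.p5.1)) ∧
      mult P s.p1.1 s.p5.1 = 1 ∧ mult P s.p1.1 s.p7.1 = 1 ∧
      mult P s.p2.1 s.p6.1 = 0 ∧ mult P s.p2.1 s.p8.1 = 0) ∨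
    (s.p9.1 = s.p2.1 ∧ s.p12.1 = s.p2.1 ∧
      ((s.p10.1 = s.p6.1 ∧ s.p11.1 = s.p8.1) ∨ (s.p10.1 = s.p8.1 ∧ s.p11.1 = s.p6.1)) ∧
      mult P s.p2.1 s.p6.1 = 1 ∧ mult P s.p2.1 s.p8.1 = 1 ∧
      mult P s.p1.1 s.p5.1 = 0 ∧ mult P s.p1.1 s.p7.1 = 0))

/-- Conjugating a pairing by a permutation of the points: the pairs of
`conj P τ` are the images under `τ` of the pairs of `P`. -/
def conj (P : Pairing n d) (τ : Equiv.Perm (Point n d)) : Pairing n d where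
  f := fun x => τ (P.f (τ.symm x))
  invol := by intro x; simp [P.invol]
  nofix := by
    intro x h
    refine P.nofix (τ.symm x) ?_
    have h3 := congrArg τ.symm h
    simpa using h3

/-- The permutation performing a d-switching: it replaces the pairs
`{1,2},{3,4},{5,6},{7,8}` by `{1,5},{3,7},{2,6},{4,8}`. -/
def dtau (s : DSwitch n d) : Equiv.Perm (Point n d) :=
  (Equiv.swap s.p4 s.p7).trans (Equiv.swap s.p2 s.p5)

/-- The pairing resulting from performing a d-switching. -/
def dResult (P : Pairing n d) (s : DSwitch n d) : Pairing n d := conj P (dtau s)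

/-- `f_I(P)`: the number of type I switchings on `P`. -/
noncomputable def fI (P : Pairing n d) : ℕ := Nat.card {s : DSwitch n d // IsTypeI P s}

/-- `f_II(P)`: the number of type II switchings on `P`. -/
noncomputable def fII (P : Pairing n d) : ℕ := Nat.card {s : DSwitch2 n d // IsTypeII P s}

/-- `b_A(P)`: the number of class A switchings from pairings in `Φ1` producing `P`. -/
noncomputable def bA (m : ℕ) (P : Pairing n d) : ℕ :=
  Nat.card {q : Pairing n d × DSwitch n d //
    q.1 ∈ Phi1 n d m ∧ IsTypeIA q.1 q.2 ∧ dResult q.1 q.2 = P}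

/-- `b_B(P)`: the number of class B switchings (of type I or type II) from
pairings in `Φ1` producing `P`. -/
noncomputable def bB (m : ℕ) (P : Pairing n d) : ℕ :=
  Nat.card {q : Pairing n d × DSwitch n d //
    q.1 ∈ Phi1 n d m ∧ IsTypeIB q.1 q.2 ∧ dResult q.1 q.2 = P} +
  Nat.card {q : Pairing n d × DSwitch2 n d //
    q.1 ∈ Phi1 n d m ∧ IsTypeII q.1 q.2 ∧ dResult q.1 q.2.toDSwitch = P}

/-- `B_D = ⌊(1+γ)(d-1)²/4⌋`. -/
noncomputable def BD (d : ℕ) (γ : ℝ) : ℕ := i1Nat d γ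

/-- `B_L = max(⌈log dn⌉, 4d)`. -/
noncomputable def BL (n d : ℕ) : ℕ := max (⌈Real.log ((d : ℝ) * n)⌉.toNat) (4 * d)

/-- `B_T = max(⌈log dn⌉, ⌈d³/n⌉)`. -/
noncomputable def BT (n d : ℕ) : ℕ :=
  max (⌈Real.log ((d : ℝ) * n)⌉.toNat) (⌈(d : ℝ) ^ 3 / (n : ℝ)⌉.toNat)

/-- The set `A` of pairings that are not initially rejected:
`D(P) ≤ B_D`, `L(P) ≤ B_L` and `T(P) ≤ B_T`. -/
def AccSet (n d : ℕ) (γ : ℝ) : Set (Pairing n d) :=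
  {P | edgesWithMult P 2 ≤ BD d γ ∧ numLoops P ≤ BL n d ∧ edgesWithMult P 3 ≤ BT n d}

/-- The stratum `S^L_i` of the loop reduction phase. -/
def SL (n d : ℕ) (γ : ℝ) (i : ℕ) : Set (Pairing n d) :=
  {P | numLoops P = i ∧ (∀ u : Fin n, loopsAt P u ≤ 1) ∧
    edgesWithMult P 2 ≤ BD d γ ∧ edgesWithMult P 3 ≤ BT n d ∧
    ∀ u v : Fin n, u ≠ v → mult P u v ≤ 3}

/-- The labelled data (points 1–6) of a type L switching. -/
structure LSwitch (n d : ℕ) where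
  q1 : Point n d
  q2 : Point n d
  q3 : Point n d
  q4 : Point n d
  q5 : Point n d
  q6 : Point n d

/-- `s` is a valid type L switching on `P`. -/
def IsLSwitch (P : Pairing n d) (s : LSwitch n d) : Prop :=
  P.f s.q1 = s.q2 ∧ s.q1.1 = s.q2.1 ∧
  P.f s.q3 = s.q4 ∧ P.f s.q5 = s.q6 ∧
  mult P s.q3.1 s.q4.1 = 1 ∧ mult P s.q5.1 s.q6.1 = 1 ∧
  [s.q1.1, s.q3.1, s.q4.1, s.q5.1, s.q6.1].Pairwise (· ≠ ·) ∧
  mult P s.q1.1 s.q3.1 = 0 ∧ mult P s.q1.1 s.q5.1 = 0 ∧ mult P s.q4.1 s.q6.1 = 0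

/-- The permutation performing a type L switching: it replaces the pairs
`{1,2},{3,4},{5,6}` by `{1,3},{2,5},{4,6}`. -/
def ltau (s : LSwitch n d) : Equiv.Perm (Point n d) :=
  (Equiv.swap s.q4 s.q5).trans (Equiv.swap s.q2 s.q3)

/-- The pairing resulting from performing a type L switching. -/
def lResult (P : Pairing n d) (s : LSwitch n d) : Pairing n d := conj P (ltau s)

/-- `f_L(P)`: the number of type L switchings on `P`. -/
noncomputable def fL (P : Pairing n d) : ℕ := Nat.card {s : LSwitch n d // IsLSwitch P s}

/-- `b_A^L(P)`: the number of type L switchings from pairings in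
`⋃_{0 ≤ j ≤ B_L} S^L_j` producing `P`. -/
noncomputable def bAL (γ : ℝ) (P : Pairing n d) : ℕ :=
  Nat.card {q : Pairing n d × LSwitch n d //
    (∃ j ≤ BL n d, q.1 ∈ SL n d γ j) ∧ IsLSwitch q.1 q.2 ∧ lResult q.1 q.2 = P}

/-- The stratum `S^T_i` of the triple-edge reduction phase. -/
def ST (n d : ℕ) (γ : ℝ) (i : ℕ) : Set (Pairing n d) :=
  {P | numLoops P = 0 ∧ edgesWithMult P 3 = i ∧ edgesWithMult P 2 ≤ BD d γ ∧
    ∀ u v : Fin n, u ≠ v → mult P u v ≤ 3}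

/-- The labelled data (points 1–12) of a type T switching. -/
structure TSwitch (n d : ℕ) where
  r1 : Point n d
  r2 : Point n d
  r3 : Point n d
  r4 : Point n d
  r5 : Point n d
  r6 : Point n d
  r7 : Point n d
  r8 : Point n d
  r9 : Point n d
  r10 : Point n d
  r11 : Point n d
  r12 : Point n d

/-- `s` is a valid type T switching on `P`. -/
def IsTSwitch (P : Pairing n d) (s : TSwitch n d) : Prop :=
  P.f s.r1 = s.r2 ∧ P.f s.r3 = s.r4 ∧ P.f s.r5 = s.r6 ∧
  P.f s.r7 = s.r8 ∧ P.f s.r9 = s.r10 ∧ P.f s.r11 = s.r12 ∧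
  s.r1.1 = s.r3.1 ∧ s.r3.1 = s.r5.1 ∧ s.r2.1 = s.r4.1 ∧ s.r4.1 = s.r6.1 ∧
  s.r1 ≠ s.r3 ∧ s.r3 ≠ s.r5 ∧ s.r1 ≠ s.r5 ∧
  mult P s.r1.1 s.r2.1 = 3 ∧
  mult P s.r7.1 s.r8.1 = 1 ∧ mult P s.r9.1 s.r10.1 = 1 ∧ mult P s.r11.1 s.r12.1 = 1 ∧
  [s.r1.1, s.r2.1, s.r7.1, s.r8.1, s.r9.1, s.r10.1, s.r11.1, s.r12.1].Pairwise (· ≠ ·) ∧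
  mult P s.r1.1 s.r7.1 = 0 ∧ mult P s.r1.1 s.r9.1 = 0 ∧ mult P s.r1.1 s.r11.1 = 0 ∧
  mult P s.r2.1 s.r8.1 = 0 ∧ mult P s.r2.1 s.r10.1 = 0 ∧ mult P s.r2.1 s.r12.1 = 0

/-- The permutation performing a type T switching: it replaces the pairs
`{1,2},{3,4},{5,6},{7,8},{9,10},{11,12}` by `{1,7},{2,8},{3,9},{4,10},{5,11},{6,12}`. -/
def ttau (s : TSwitch n d) : Equiv.Perm (Point n d) :=
  ((Equiv.swap s.r2 s.r7).trans (Equiv.swap s.r4 s.r9)).trans (Equiv.swap s.r6 s.r11)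

/-- The pairing resulting from performing a type T switching. -/
def tResult (P : Pairing n d) (s : TSwitch n d) : Pairing n d := conj P (ttau s)

/-- `f_T(P)`: the number of type T switchings on `P`. -/
noncomputable def fT (P : Pairing n d) : ℕ := Nat.card {s : TSwitch n d // IsTSwitch P s}

/-- `b_A^T(P)`: the number of type T switchings from pairings in
`⋃_{0 ≤ j ≤ B_T} S^T_j` producing `P`. -/
noncomputable def bAT (γ : ℝ) (P : Pairing n d) : ℕ :=
  Nat.card {q : Pairing n d × TSwitch n d //
    (∃ j ≤ BT n d, q.1 ∈ ST n d γ j) ∧ IsTSwitch q.1 q.2 ∧ tResult q.1 q.2 = P}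

/-- The endpoints of the pair of `P` containing the point `a` lie in bins
`w1, w2` such that `u, v, w1, w2` are four distinct bins, `w1` is adjacent to `u`
and `w2` is adjacent to `v`. -/
def GoodPair (u v : Fin n) (P : Pairing n d) (a : Point n d) : Prop :=
  ∃ w1 w2 : Fin n,
    ((w1 = a.1 ∧ w2 = (P.f a).1) ∨ (w1 = (P.f a).1 ∧ w2 = a.1)) ∧
    [u, v, w1, w2].Pairwise (· ≠ ·) ∧ Adj P w1 u ∧ Adj P w2 v

/-- Four times the number of unordered pairs `{e, e'}` of distinct pairs of `P`
joining the same two distinct bins: ordered pairs of points `(a, b)` lying in a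
common bin whose mates also lie in a common (different) bin. -/
def parallelOrdered (P : Pairing n d) : ℕ :=
  (Finset.univ.filter fun q : Point n d × Point n d =>
    q.1.1 = q.2.1 ∧ (P.f q.1).1 = (P.f q.2).1 ∧ q.1.1 ≠ (P.f q.1).1 ∧ q.1 ≠ q.2).card

/-- Twice the number of unordered pairs of two distinct double edges of `P`
sharing a common bin (double edges being recorded as ordered bin-pairs `(u,v)`
with `u < v`). -/
def doubleSharedOrdered (P : Pairing n d) : ℕ :=
  (Finset.univ.filter fun q : (Fin n × Fin n) × (Fin n × Fin n) =>
    q.1.1 < q.1.2 ∧ q.2.1 < q.2.2 ∧ mult P q.1.1 q.1.2 = 2 ∧ mult P q.2.1 q.2.2 = 2 ∧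
    q.1 ≠ q.2 ∧
    (q.1.1 = q.2.1 ∨ q.1.1 = q.2.2 ∨ q.1.2 = q.2.1 ∨ q.1.2 = q.2.2)).card

/-- `m̄_I(i) = 4 i (M1 - 4i)²`. -/
noncomputable def mbarIp (nR dR : ℝ) (i : ℕ) : ℝ := 4 * i * (dR * nR - 4 * i) ^ 2

/-- `m̄_II(i) = 16 i (d-1)² (d-2) (d-3)`. -/
noncomputable def mbarIIp (dR : ℝ) (i : ℕ) : ℝ :=
  16 * i * (dR - 1) ^ 2 * (dR - 2) * (dR - 3)

/-- `m̲_A(i) = M2² - M2 (d-1) (16 i + 3d² + d + 6)`. -/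
noncomputable def mAp (nR dR : ℝ) (i : ℕ) : ℝ :=
  (nR * dR * (dR - 1)) ^ 2 - nR * dR * (dR - 1) * (dR - 1) * (16 * i + 3 * dR ^ 2 + dR + 6)

/-- `m̲_B(i) = 16 i (d-2) M2 - 16 i d (8 i d + 9 d² + 3 d³)`. -/
noncomputable def mBp (nR dR : ℝ) (i : ℕ) : ℝ :=
  16 * i * (dR - 2) * (nR * dR * (dR - 1)) - 16 * i * dR * (8 * i * dR + 9 * dR ^ 2 + 3 * dR ^ 3)

/-- The system of equations (18)–(21) of the paper determining the type
probabilities `ρ_I, ρ_II` and the (scaled) expected numbers of visits `x_j`,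
together with the positivity requirement on the `x_j`. -/
def Sys (nR dR ε : ℝ) (m : ℕ) (x ρI ρII : ℕ → ℝ) : Prop :=
  (∀ j ≤ m, 0 < x j) ∧
  (∀ i : ℕ, 1 ≤ i → i ≤ m → ρI i = 1 - ε) ∧
  ρI 0 = 0 ∧ ρII 0 = 0 ∧ ρII m = 0 ∧
  (∀ j : ℕ, 1 ≤ j → j + 1 ≤ m →
    x j = 1 + x (j + 1) * ρI (j + 1) * mAp nR dR j / mbarIp nR dR (j + 1)
        + x j * ρI j * mBp nR dR j / mbarIp nR dR j) ∧
  (x m = 1 + x m * ρI m * mBp nR dR m / mbarIp nR dR m) ∧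
  (x 0 = 1 + x 1 * ρI 1 * mAp nR dR 0 / mbarIp nR dR 1) ∧
  (∀ j : ℕ, j + 1 ≤ m →
    ρII j = ρI (j + 1) * (x (j + 1) / x j) * (mbarIIp dR j / mbarIp nR dR (j + 1)))

/-- The explicit unique positive root `x(d)`. -/
noncomputable def xd (dR : ℝ) : ℝ :=
  (7 / 2) * dR - 7 / 2 + 5 / dR +
    (1 / (2 * dR)) * Real.sqrt (65 * dR ^ 4 - 210 * dR ^ 3 + 461 * dR ^ 2 - 412 * dR + 196)

/-- The points lying in a double edge of `P`. -/
def doublePoints (P : Pairing n d) : Finset (Point n d) :=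
  Finset.univ.filter fun a => a.1 ≠ (P.f a).1 ∧ mult P a.1 (P.f a).1 = 2

/-- The points lying in a single edge of `P`. -/
def singlePoints (P : Pairing n d) : Finset (Point n d) :=
  Finset.univ.filter fun a => mult P a.1 (P.f a).1 = 1

theorem mult_comm (P : Pairing n d) (u v : Fin n) : mult P u v = mult P v u := by
  refine Finset.card_bij' (fun a _ => P.f a) (fun a _ => P.f a) ?_ ?_ ?_ ?_
  · intro a ha
    simp only [Finset.mem_filter, Finset.mem_univ, true_and] at ha ⊢
    rw [P.invol]; exact ha.symm
  · intro a ha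
    simp only [Finset.mem_filter, Finset.mem_univ, true_and] at ha ⊢
    rw [P.invol]; exact ha.symm
  · intro a _; exact P.invol a
  · intro a _; exact P.invol a

theorem card_orderedDoubleEdges (P : Pairing n d) :
    (Finset.univ.filter fun q : Fin n × Fin n => q.1 ≠ q.2 ∧ mult P q.1 q.2 = 2).card
      = 2 * edgesWithMult P 2 := by
  have hsplit : (Finset.univ.filter fun q : Fin n × Fin n => q.1 ≠ q.2 ∧ mult P q.1 q.2 = 2)
      = (Finset.univ.filter fun q : Fin n × Fin n => q.1 < q.2 ∧ mult P q.1 q.2 = 2) ∪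
        (Finset.univ.filter fun q : Fin n × Fin n => q.2 < q.1 ∧ mult P q.1 q.2 = 2) := by
    ext q
    simp only [Finset.mem_filter, Finset.mem_univ, true_and, Finset.mem_union, ne_iff_lt_or_gt]
    tauto
  have hswap : (Finset.univ.filter fun q : Fin n × Fin n =>
      q.2 < q.1 ∧ mult P q.1 q.2 = 2).card = edgesWithMult P 2 := by
    refine Finset.card_bij' (fun q _ => q.swap) (fun q _ => q.swap) ?_ ?_ ?_ ?_ <;>
      simp [mult_comm P]
  rw [hsplit, Finset.card_union_of_disjoint, hswap, two_mul]
  · rfl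
  · rw [Finset.disjoint_filter]
    rintro q - ⟨h, -⟩ ⟨h', -⟩
    exact lt_asymm h h'

theorem card_doublePoints (P : Pairing n d) :
    (doublePoints P).card = 4 * edgesWithMult P 2 := by
  rw [Finset.card_eq_sum_card_fiberwise (f := fun a => (a.1, (P.f a).1))
    (t := Finset.univ.filter fun q : Fin n × Fin n => q.1 ≠ q.2 ∧ mult P q.1 q.2 = 2)]
  · rw [Finset.sum_const_nat (m := 2), card_orderedDoubleEdges]
    · ring
    · rintro ⟨u, v⟩ hq
      simp only [Finset.mem_filter, Finset.mem_univ, true_and] at hq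
      rw [← hq.2, mult]
      congr 1
      ext a
      simp only [doublePoints, Finset.mem_filter, Finset.mem_univ, true_and, Prod.mk.injEq]
      constructor
      · exact fun h => h.2
      · rintro ⟨rfl, rfl⟩
        exact ⟨hq, rfl, rfl⟩
  · intro a ha
    simpa [doublePoints] using ha

theorem card_doublePoints_add_card_singlePoints_le (P : Pairing n d) :
    (doublePoints P).card + (singlePoints P).card ≤ n * d := by
  rw [← Finset.card_union_of_disjoint]
  · exact (Finset.card_le_univ _).trans_eq (by simp)
  · rw [doublePoints, singlePoints, Finset.disjoint_filter]
    rintro a - ⟨-, h⟩ h'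
    omega

/-- A pair of a double edge has only one parallel pair. -/
theorem eq_of_parallel {P : Pairing n d} {a b c : Point n d}
    (hm : mult P a.1 (P.f a).1 = 2) (hb : b.1 = a.1) (hb' : (P.f b).1 = (P.f a).1) (hab : a ≠ b)
    (hc : c.1 = a.1) (hc' : (P.f c).1 = (P.f a).1) (hac : a ≠ c) : b = c := by
  by_contra hbc
  have hsub : ({a, b, c} : Finset (Point n d)) ⊆
      Finset.univ.filter fun x : Point n d => x.1 = a.1 ∧ (P.f x).1 = (P.f a).1 := by
    intro x hx
    simp only [Finset.mem_insert, Finset.mem_singleton] at hx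
    rcases hx with rfl | rfl | rfl <;> simp [*]
  have hcard := Finset.card_le_card hsub
  rw [Finset.card_eq_three.mpr ⟨a, b, c, hab, hac, hbc, rfl⟩] at hcard
  rw [mult] at hm
  omega

/-- A d-switching on `P` is determined by its points `1`, `5`, `7`. -/
theorem IsDSwitch.eq_of_points {P : Pairing n d} {s t : DSwitch n d}
    (hs : IsDSwitch P s) (ht : IsDSwitch P t)
    (h1 : s.p1 = t.p1) (h5 : s.p5 = t.p5) (h7 : s.p7 = t.p7) : s = t := by
  obtain ⟨s1, s2, s3, s4, s5, s6, s7, s8⟩ := s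
  obtain ⟨t1, t2, t3, t4, t5, t6, t7, t8⟩ := t
  simp only [IsDSwitch] at hs ht h1 h5 h7
  obtain ⟨rfl, rfl, rfl, rfl, hs13, hs24, hs1ne3, hsm, -⟩ := hs
  obtain ⟨rfl, rfl, rfl, rfl, ht13, ht24, ht1ne3, -⟩ := ht
  subst h1 h5 h7
  obtain rfl := eq_of_parallel hsm hs13.symm hs24.symm hs1ne3 ht13.symm ht24.symm ht1ne3
  rfl

theorem fI_le (P : Pairing n d) :
    fI P ≤ (doublePoints P).card * (singlePoints P).card ^ 2 := by
  have hmem (s : {s : DSwitch n d // IsTypeI P s}) :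
      (s.1.p1, s.1.p5, s.1.p7) ∈ doublePoints P ×ˢ singlePoints P ×ˢ singlePoints P := by
    obtain ⟨s, ⟨h12, -, h56, h78, -, -, -, hm, hm', hm'', hne⟩, -⟩ := s
    simp only [List.pairwise_cons, List.mem_cons] at hne
    simp only [Finset.mem_product, doublePoints, singlePoints, Finset.mem_filter,
      Finset.mem_univ, true_and, h12, h56, h78]
    exact ⟨⟨hne.1 _ (Or.inl rfl), hm⟩, hm', hm''⟩
  have hle := Nat.card_le_card_of_injective
    (β := (doublePoints P ×ˢ singlePoints P ×ˢ singlePoints P : Finset _))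
    (fun s : {s : DSwitch n d // IsTypeI P s} => ⟨_, hmem s⟩) fun s t h => by
      simp only [Subtype.mk.injEq, Prod.mk.injEq] at h
      exact Subtype.ext (s.2.1.eq_of_points t.2.1 h.1 h.2.1 h.2.2)
  rw [Nat.card_eq_finsetCard, Finset.card_product,
    Finset.card_product] at hle
  rw [sq]
  exact hle

/-- For every `1 ≤ i ≤ i1` and every pairing `P ∈ S_i`, the number of type I
switchings on `P` satisfies `f_I(P) ≤ 4 i (M1 - 4i)²`. -/
theorem stmt_0 (n d : ℕ) (hn : 0 < n) (hd : 0 < d) (he : Even (d * n))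
    (γ : ℝ) (hγ : 0 < γ) (i : ℕ) (hi1 : 1 ≤ i) (hi2 : i ≤ i1Nat d γ)
    (P : Pairing n d) (hP : P ∈ SD n d i) :
    (fI P : ℝ) ≤ 4 * i * (M1R n d - 4 * i) ^ 2 := by
  obtain ⟨-, -, rfl⟩ := hP
  have hD := card_doublePoints P
  have hS := card_doublePoints_add_card_singlePoints_le P
  have hf := fI_le P
  rw [hD] at hS hf
  have hS' : ((singlePoints P).card : ℝ) ≤ M1R n d - 4 * (edgesWithMult P 2 : ℝ) := by
    have : (4 * (edgesWithMult P 2 : ℝ)) + (singlePoints P).card ≤ n * d := by exact_mod_cast hS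
    rw [M1R]
    linarith
  calc (fI P : ℝ) ≤ 4 * (edgesWithMult P 2 : ℝ) * ((singlePoints P).card : ℝ) ^ 2 := by
        exact_mod_cast hf
    _ ≤ _ := by gcongr

end Reg
end

section
/- Let n, d be positive integers with dn even and fix a constant γ > 0. For every i with 0 ≤ i ≤ i1 and every pairing P ∈ S_i, the number of class B switchings producing P satisfies b_B(P) ≥ 16·i·(d−2)·M2 − 16·i·d·(8id + 9d² + 3d³). -/
/-!
Formalization of the pairing model of random `d`-regular (multi)graphs and of the
switchings used in the uniform sampler *REG* of Gao and Wormald,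
"Uniform generation of random regular graphs".

Bins are elements of `Fin n`; each bin contains `d` points, so points are
elements of `Fin n × Fin d`.  A pairing is a perfect matching of the points,
modelled as a fixed-point-free involution on the points: the pairs of the
pairing are the orbits `{x, P.f x}`.
-/

namespace Reg

variable {n d : ℕ}

theorem Pairing.f_eq_comm (P : Pairing n d) {a b : Point n d} (h : P.f a = b) : P.f b = a := by
  rw [← h, P.invol]

/-- The indicator that `a` is a point of bin `u` matched with a point of bin `v`. -/
def joinInd (P : Pairing n d) (u v : Fin n) (a : Point n d) : ℕ :=
  if a.1 = u ∧ (P.f a).1 = v then 1 else 0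

theorem mult_eq_sum (P : Pairing n d) (u v : Fin n) : mult P u v = ∑ a, joinInd P u v a :=
  Finset.card_filter _ _

theorem one_le_mult (P : Pairing n d) (a : Point n d) : 1 ≤ mult P a.1 (P.f a).1 :=
  Finset.card_pos.2 ⟨a, by simp⟩

/-- Two pairings agreeing outside a list of points have multiplicities differing only by the
contributions of those points. -/
theorem mult_add_sum_joinInd (P Q : Pairing n d) (l : List (Point n d)) (hl : l.Nodup)
    (h : ∀ x ∉ l, Q.f x = P.f x) (u v : Fin n) :
    mult Q u v + (l.map (joinInd P u v)).sum = mult P u v + (l.map (joinInd Q u v)).sum := by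
  rw [mult_eq_sum, mult_eq_sum, ← List.sum_toFinset _ hl, ← List.sum_toFinset _ hl,
    ← Finset.sum_add_sum_compl l.toFinset (joinInd P u v),
    ← Finset.sum_add_sum_compl l.toFinset (joinInd Q u v)]
  have hsum : ∑ a ∈ l.toFinsetᶜ, joinInd Q u v a = ∑ a ∈ l.toFinsetᶜ, joinInd P u v a :=
    Finset.sum_congr rfl fun a ha => by
      simp only [Finset.mem_compl, List.mem_toFinset] at ha
      simp [joinInd, h a ha]
  rw [hsum]
  ring

/-- The d-switching with points `1, 3, 2, 4` equal to `p, q, r, t` whose result is `P`. -/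
def switchTo (P : Pairing n d) (p q r t : Point n d) : DSwitch n d :=
  ⟨p, r, q, t, P.f p, P.f r, P.f q, P.f t⟩

/-- The conditions under which the d-switching `switchTo P p q r t` can be undone. -/
structure Reversible (P : Pairing n d) (p q r t : Point n d) : Prop where
  fst_eq : p.1 = q.1
  fst_eq' : r.1 = t.1
  bins : [p.1, r.1, (P.f p).1, (P.f r).1, (P.f q).1, (P.f t).1].Pairwise (· ≠ ·)
  mult_centres : mult P p.1 r.1 = 0
  mult_left : mult P (P.f p).1 (P.f r).1 = 0
  mult_right : mult P (P.f q).1 (P.f t).1 = 0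

/-- The pairing from which `switchTo P p q r t` produces `P`. -/
def undo (P : Pairing n d) (p q r t : Point n d) : Pairing n d :=
  conj P (dtau (switchTo P p q r t)).symm

theorem dResult_undo (P : Pairing n d) (p q r t : Point n d) :
    dResult (undo P p q r t) (switchTo P p q r t) = P := by
  cases P
  simp [dResult, undo, conj]

theorem undo_of_notMem (P : Pairing n d) (p q r t : Point n d) {x : Point n d}
    (hx : x ∉ [p, r, q, t, P.f p, P.f r, P.f q, P.f t]) : (undo P p q r t).f x = P.f x := by
  have hinj : ∀ a, P.f x = a → x = P.f a := fun a ha => (P.f_eq_comm ha).symm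
  have := P.invol
  simp only [List.mem_cons, List.not_mem_nil] at hx
  simp only [undo, conj, dtau, switchTo, Equiv.symm_symm, Equiv.symm_trans_apply,
    Equiv.trans_apply, Equiv.symm_swap, Equiv.swap_apply_def]
  grind

namespace Reversible

variable {P : Pairing n d} {p q r t : Point n d}

theorem reverse (h : Reversible P p q r t) : Reversible P q p t r := by
  obtain ⟨h1, h2, h3, h4, h5, h6⟩ := h
  refine ⟨h1.symm, h2.symm, ?_, h1 ▸ h2 ▸ h4, h6, h5⟩
  simp only [List.pairwise_cons, List.mem_cons, List.not_mem_nil] at h3 ⊢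
  grind

theorem exchange (h : Reversible P p q r t) : Reversible P r t p q := by
  obtain ⟨h1, h2, h3, h4, h5, h6⟩ := h
  refine ⟨h2, h1, ?_, mult_comm P _ _ ▸ h4, mult_comm P _ _ ▸ h5, mult_comm P _ _ ▸ h6⟩
  simp only [List.pairwise_cons, List.mem_cons, List.not_mem_nil] at h3 ⊢
  grind

theorem nodup (h : Reversible P p q r t) :
    [p, r, q, t, P.f p, P.f r, P.f q, P.f t].Nodup := by
  obtain ⟨h1, h2, h3, -, -, -⟩ := h
  simp only [List.pairwise_cons, List.mem_cons, List.not_mem_nil] at h3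
  simp only [List.nodup_cons, List.mem_cons, List.not_mem_nil]
  refine ⟨?_, ?_, ?_, ?_, ?_, ?_, ?_, ?_⟩ <;> grind

theorem undo_p (h : Reversible P p q r t) : (undo P p q r t).f p = r := by
  have hn := h.nodup
  simp only [List.nodup_cons, List.mem_cons, List.not_mem_nil] at hn
  simp only [undo, conj, dtau, switchTo, Equiv.symm_symm, Equiv.symm_trans_apply,
    Equiv.trans_apply, Equiv.symm_swap, Equiv.swap_apply_def]
  grind

theorem undo_q (h : Reversible P p q r t) : (undo P p q r t).f q = t := by
  have hn := h.nodup
  simp only [List.nodup_cons, List.mem_cons, List.not_mem_nil] at hn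
  simp only [undo, conj, dtau, switchTo, Equiv.symm_symm, Equiv.symm_trans_apply,
    Equiv.trans_apply, Equiv.symm_swap, Equiv.swap_apply_def]
  grind

theorem undo_f_p (h : Reversible P p q r t) : (undo P p q r t).f (P.f p) = P.f r := by
  have hn := h.nodup
  simp only [List.nodup_cons, List.mem_cons, List.not_mem_nil] at hn
  simp only [undo, conj, dtau, switchTo, Equiv.symm_symm, Equiv.symm_trans_apply,
    Equiv.trans_apply, Equiv.symm_swap, Equiv.swap_apply_def]
  grind

theorem undo_f_q (h : Reversible P p q r t) : (undo P p q r t).f (P.f q) = P.f t := by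
  have hn := h.nodup
  simp only [List.nodup_cons, List.mem_cons, List.not_mem_nil] at hn
  simp only [undo, conj, dtau, switchTo, Equiv.symm_symm, Equiv.symm_trans_apply,
    Equiv.trans_apply, Equiv.symm_swap, Equiv.swap_apply_def]
  grind

/-- How the multiplicities change when a d-switching is undone. -/
theorem mult_undo (h : Reversible P p q r t) (u v : Fin n) :
    let e : Fin n → Fin n → ℕ := fun x y =>
      (if x = u ∧ y = v then 1 else 0) + if y = u ∧ x = v then 1 else 0
    mult (undo P p q r t) u v +
        (e p.1 (P.f p).1 + e p.1 (P.f q).1 + e r.1 (P.f r).1 + e r.1 (P.f t).1) =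
      mult P u v + (2 * e p.1 r.1 + e (P.f p).1 (P.f r).1 + e (P.f q).1 (P.f t).1) := by
  intro e
  have key := mult_add_sum_joinInd P (undo P p q r t) _ h.nodup
    (fun x hx => undo_of_notMem P p q r t hx) u v
  have e1 : (undo P p q r t).f r = p := Pairing.f_eq_comm _ h.undo_p
  have e2 : (undo P p q r t).f t = q := Pairing.f_eq_comm _ h.undo_q
  have e3 : (undo P p q r t).f (P.f r) = P.f p := Pairing.f_eq_comm _ h.undo_f_p
  have e4 : (undo P p q r t).f (P.f t) = P.f q := Pairing.f_eq_comm _ h.undo_f_q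
  simp only [List.map_cons, List.map_nil, List.sum_cons, List.sum_nil, joinInd, P.invol,
    h.undo_p, h.undo_q, h.undo_f_p, h.undo_f_q, e1, e2, e3, e4, ← h.fst_eq, ← h.fst_eq'] at key
  simp only [e]
  omega

end Reversible

theorem mult_self_eq_zero {P : Pairing n d} (h : numLoops P = 0) (u : Fin n) : mult P u u = 0 := by
  refine Finset.card_eq_zero.2 (Finset.filter_eq_empty_iff.2 fun a _ ⟨ha, hb⟩ => ?_)
  have : 2 ≤ (Finset.univ.filter fun a : Point n d => (P.f a).1 = a.1).card := by
    rw [← Finset.card_pair (P.nofix a)]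
    refine Finset.card_le_card fun x hx => ?_
    rcases Finset.mem_insert.1 hx with rfl | hx
    · simp [P.invol, ha, hb]
    · simp [Finset.mem_singleton.1 hx, ha, hb]
  unfold numLoops at h
  omega

theorem bin_ne {P : Pairing n d} (h : ∀ u, mult P u u = 0) (a : Point n d) : a.1 ≠ (P.f a).1 := by
  intro ha
  have h1 := one_le_mult P a
  rw [← ha, h a.1] at h1
  omega

/-- An unordered pair of bins recorded with the smaller bin first. -/
def sortBins (u v : Fin n) : Fin n × Fin n := (min u v, max u v)

theorem mult_sortBins (P : Pairing n d) (u v : Fin n) :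
    mult P (sortBins u v).1 (sortBins u v).2 = mult P u v := by
  rcases le_total u v with h | h
  · simp [sortBins, h]
  · simp [sortBins, h, mult_comm P v u]

theorem sortBins_lt {u v : Fin n} (h : u ≠ v) : (sortBins u v).1 < (sortBins u v).2 := by
  simpa [sortBins] using h.symm

theorem sortBins_eq_of_lt {u v : Fin n} {q : Fin n × Fin n} (hq : q.1 < q.2)
    (h : (u = q.1 ∧ v = q.2) ∨ (v = q.1 ∧ u = q.2)) : sortBins u v = q := by
  rcases h with ⟨rfl, rfl⟩ | ⟨rfl, rfl⟩ <;> simp [sortBins, hq.le]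

namespace Reversible

variable {P : Pairing n d} {p q r t : Point n d}

theorem mult_undo_centres (h : Reversible P p q r t) :
    mult (undo P p q r t) p.1 r.1 = 2 := by
  have hm := h.mult_undo p.1 r.1
  have h0 := h.mult_centres
  have hb := h.bins
  simp only [List.pairwise_cons, List.mem_cons, List.not_mem_nil] at hb
  grind

theorem mult_undo_left (h : Reversible P p q r t) :
    mult (undo P p q r t) (P.f p).1 (P.f r).1 = 1 := by
  have hm := h.mult_undo (P.f p).1 (P.f r).1
  have h0 := h.mult_left
  have hb := h.bins
  simp only [List.pairwise_cons, List.mem_cons, List.not_mem_nil] at hb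
  grind

theorem mult_undo_target (h : Reversible P p q r t) :
    mult (undo P p q r t) p.1 (P.f p).1 + 1 = mult P p.1 (P.f p).1 := by
  have hm := h.mult_undo p.1 (P.f p).1
  have hb := h.bins
  simp only [List.pairwise_cons, List.mem_cons, List.not_mem_nil] at hb
  grind

theorem undo_reverse (h : Reversible P p q r t) : undo P q p t r = undo P p q r t := by
  have hx : (undo P q p t r).f = (undo P p q r t).f := by
    funext x
    by_cases hx : x ∈ [p, r, q, t, P.f p, P.f r, P.f q, P.f t]
    · simp only [List.mem_cons, List.not_mem_nil, or_false] at hx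
      rcases hx with rfl | rfl | rfl | rfl | rfl | rfl | rfl | rfl
      · rw [h.undo_p, h.reverse.undo_q]
      · rw [Pairing.f_eq_comm _ h.undo_p, Pairing.f_eq_comm _ h.reverse.undo_q]
      · rw [h.undo_q, h.reverse.undo_p]
      · rw [Pairing.f_eq_comm _ h.undo_q, Pairing.f_eq_comm _ h.reverse.undo_p]
      · rw [h.undo_f_p, h.reverse.undo_f_q]
      · rw [Pairing.f_eq_comm _ h.undo_f_p, Pairing.f_eq_comm _ h.reverse.undo_f_q]
      · rw [h.undo_f_q, h.reverse.undo_f_p]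
      · rw [Pairing.f_eq_comm _ h.undo_f_q, Pairing.f_eq_comm _ h.reverse.undo_f_p]
    · rw [undo_of_notMem P p q r t hx, undo_of_notMem]
      simpa [and_comm, and_left_comm, and_assoc, or_comm, or_left_comm, or_assoc] using hx
  revert hx
  generalize undo P q p t r = A
  generalize undo P p q r t = B
  intro hx
  cases A; cases B; congr

theorem undo_exchange (h : Reversible P p q r t) : undo P r t p q = undo P p q r t := by
  have hx : (undo P r t p q).f = (undo P p q r t).f := by
    funext x
    by_cases hx : x ∈ [p, r, q, t, P.f p, P.f r, P.f q, P.f t]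
    · simp only [List.mem_cons, List.not_mem_nil, or_false] at hx
      rcases hx with rfl | rfl | rfl | rfl | rfl | rfl | rfl | rfl
      · rw [h.undo_p, Pairing.f_eq_comm _ h.exchange.undo_p]
      · rw [Pairing.f_eq_comm _ h.undo_p, h.exchange.undo_p]
      · rw [h.undo_q, Pairing.f_eq_comm _ h.exchange.undo_q]
      · rw [Pairing.f_eq_comm _ h.undo_q, h.exchange.undo_q]
      · rw [h.undo_f_p, Pairing.f_eq_comm _ h.exchange.undo_f_p]
      · rw [Pairing.f_eq_comm _ h.undo_f_p, h.exchange.undo_f_p]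
      · rw [h.undo_f_q, Pairing.f_eq_comm _ h.exchange.undo_f_q]
      · rw [Pairing.f_eq_comm _ h.undo_f_q, h.exchange.undo_f_q]
    · rw [undo_of_notMem P p q r t hx, undo_of_notMem]
      simpa [and_comm, and_left_comm, and_assoc, or_comm, or_left_comm, or_assoc] using hx
  revert hx
  generalize undo P r t p q = A
  generalize undo P p q r t = B
  intro hx
  cases A; cases B; congr

/-- The bin-pairs that gain a pair when a d-switching is undone. -/
theorem mult_undo_le (h : Reversible P p q r t) {u v : Fin n}
    (h1 : ¬((p.1 = u ∧ r.1 = v) ∨ (r.1 = u ∧ p.1 = v)))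
    (h2 : ¬(((P.f p).1 = u ∧ (P.f r).1 = v) ∨ ((P.f r).1 = u ∧ (P.f p).1 = v)))
    (h3 : ¬(((P.f q).1 = u ∧ (P.f t).1 = v) ∨ ((P.f t).1 = u ∧ (P.f q).1 = v))) :
    mult (undo P p q r t) u v ≤ mult P u v := by
  have hm := h.mult_undo u v
  rw [not_or] at h1 h2 h3
  simp only [if_neg h1.1, if_neg h1.2, if_neg h2.1, if_neg h2.2, if_neg h3.1, if_neg h3.2] at hm
  omega

theorem mult_undo_right (h : Reversible P p q r t) :
    mult (undo P p q r t) (P.f q).1 (P.f t).1 = 1 :=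
  h.undo_reverse ▸ h.reverse.mult_undo_left

theorem mult_undo_le_two (h : Reversible P p q r t) (hP : ∀ u v, u ≠ v → mult P u v ≤ 2)
    {u v : Fin n} (huv : u ≠ v) : mult (undo P p q r t) u v ≤ 2 := by
  by_cases h1 : (p.1 = u ∧ r.1 = v) ∨ (r.1 = u ∧ p.1 = v)
  · rcases h1 with ⟨rfl, rfl⟩ | ⟨rfl, rfl⟩
    · exact h.mult_undo_centres.le
    · exact mult_comm _ _ _ ▸ h.mult_undo_centres.le
  by_cases h2 : ((P.f p).1 = u ∧ (P.f r).1 = v) ∨ ((P.f r).1 = u ∧ (P.f p).1 = v)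
  · rcases h2 with ⟨rfl, rfl⟩ | ⟨rfl, rfl⟩
    · exact h.mult_undo_left.le.trans one_le_two
    · exact mult_comm _ _ _ ▸ h.mult_undo_left.le.trans one_le_two
  by_cases h3 : ((P.f q).1 = u ∧ (P.f t).1 = v) ∨ ((P.f t).1 = u ∧ (P.f q).1 = v)
  · rcases h3 with ⟨rfl, rfl⟩ | ⟨rfl, rfl⟩
    · exact h.mult_undo_right.le.trans one_le_two
    · exact mult_comm _ _ _ ▸ h.mult_undo_right.le.trans one_le_two
  exact (h.mult_undo_le h1 h2 h3).trans (hP u v huv)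

theorem mult_undo_self (h : Reversible P p q r t) (hP : ∀ u, mult P u u = 0) (u : Fin n) :
    mult (undo P p q r t) u u = 0 := by
  have hb := h.bins
  simp only [List.pairwise_cons, List.mem_cons, List.not_mem_nil] at hb
  refine Nat.le_zero.1 ((h.mult_undo_le ?_ ?_ ?_).trans (hP u).le) <;> grind

/-- Undoing a d-switching that creates a double edge does not increase the number of
double edges. -/
theorem edgesWithMult_undo_le (h : Reversible P p q r t)
    (hP : ∀ u v, u ≠ v → mult P u v ≤ 2) (hp : mult P p.1 (P.f p).1 = 2) :
    edgesWithMult (undo P p q r t) 2 ≤ edgesWithMult P 2 := by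
  have hb := h.bins
  simp only [List.pairwise_cons, List.mem_cons, List.not_mem_nil] at hb
  set D := Finset.univ.filter fun z : Fin n × Fin n => z.1 < z.2 ∧ mult P z.1 z.2 = 2 with hD
  have hmem : sortBins p.1 (P.f p).1 ∈ D := by
    rw [hD, Finset.mem_filter]
    exact ⟨Finset.mem_univ _, sortBins_lt (by grind), by rw [mult_sortBins, hp]⟩
  have hsub : (Finset.univ.filter fun z : Fin n × Fin n =>
      z.1 < z.2 ∧ mult (undo P p q r t) z.1 z.2 = 2) ⊆
      insert (sortBins p.1 r.1) (D.erase (sortBins p.1 (P.f p).1)) := by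
    intro z hz
    obtain ⟨hz1, hz2⟩ := (Finset.mem_filter.1 hz).2
    rw [Finset.mem_insert, Finset.mem_erase]
    by_cases h1 : (p.1 = z.1 ∧ r.1 = z.2) ∨ (r.1 = z.1 ∧ p.1 = z.2)
    · exact Or.inl (sortBins_eq_of_lt hz1 h1).symm
    refine Or.inr ⟨?_, ?_⟩
    · rintro rfl
      rw [mult_sortBins] at hz2
      have := h.mult_undo_target
      omega
    · have h2 : ¬(((P.f p).1 = z.1 ∧ (P.f r).1 = z.2) ∨ ((P.f r).1 = z.1 ∧ (P.f p).1 = z.2)) := by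
        have h2' := h.mult_undo_left
        have := mult_comm (undo P p q r t) z.1 z.2
        rintro (⟨h3, h4⟩ | ⟨h3, h4⟩) <;> rw [h3, h4] at h2' <;> omega
      have h3 : ¬(((P.f q).1 = z.1 ∧ (P.f t).1 = z.2) ∨ ((P.f t).1 = z.1 ∧ (P.f q).1 = z.2)) := by
        have h2' := h.mult_undo_right
        have := mult_comm (undo P p q r t) z.1 z.2
        rintro (⟨h3, h4⟩ | ⟨h3, h4⟩) <;> rw [h3, h4] at h2' <;> omega
      have hle := h.mult_undo_le h1 h2 h3
      have hle' := hP z.1 z.2 hz1.ne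
      rw [hD, Finset.mem_filter]
      exact ⟨Finset.mem_univ _, hz1, by omega⟩
  calc _ ≤ _ := Finset.card_le_card hsub
    _ ≤ (D.erase (sortBins p.1 (P.f p).1)).card + 1 := Finset.card_insert_le _ _
    _ = _ := Finset.card_erase_add_one hmem

end Reversible

theorem numLoops_eq_zero {P : Pairing n d} (h : ∀ u, mult P u u = 0) : numLoops P = 0 := by
  unfold numLoops
  rw [Finset.filter_eq_empty_iff.2 fun a _ ha => bin_ne h a ha.symm,
    Finset.card_empty]

/-- In a double edge, every point has a partner in its bin. -/
theorem exists_partner (P : Pairing n d) (a : Point n d) (h : mult P a.1 (P.f a).1 = 2) :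
    ∃ c, c ≠ a ∧ c.1 = a.1 ∧ (P.f c).1 = (P.f a).1 := by
  obtain ⟨c, hc, hca⟩ := Finset.exists_mem_ne (by rw [← mult, h]; exact one_lt_two) a
  exact ⟨c, hca, (Finset.mem_filter.1 hc).2⟩

namespace Reversible

variable {P : Pairing n d} {p q r t : Point n d}

theorem isDSwitch_undo (h : Reversible P p q r t) :
    IsDSwitch (undo P p q r t) (switchTo P p q r t) := by
  refine ⟨h.undo_p, h.undo_q, h.undo_f_p, h.undo_f_q, h.fst_eq, h.fst_eq', ?_,
    h.mult_undo_centres, h.mult_undo_left, h.mult_undo_right, h.bins⟩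
  have hn := h.nodup
  simp only [List.nodup_cons, List.mem_cons, List.not_mem_nil] at hn
  simp only [switchTo]
  grind

theorem mult_undo_target_q (h : Reversible P p q r t) :
    mult (undo P p q r t) p.1 (P.f q).1 + 1 = mult P q.1 (P.f q).1 := by
  rw [← h.undo_reverse, h.fst_eq, h.reverse.mult_undo_target]

theorem mult_undo_target_r (h : Reversible P p q r t) :
    mult (undo P p q r t) r.1 (P.f r).1 + 1 = mult P r.1 (P.f r).1 := by
  rw [← h.undo_exchange, h.exchange.mult_undo_target]

theorem mult_undo_target_t (h : Reversible P p q r t) :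
    mult (undo P p q r t) r.1 (P.f t).1 + 1 = mult P t.1 (P.f t).1 := by
  rw [← h.undo_exchange, h.exchange.mult_undo_target_q]

theorem undo_mem_Phi1 (h : Reversible P p q r t) {i m : ℕ} (hi : i ≤ m) (hP : P ∈ SD n d i)
    (hp : mult P p.1 (P.f p).1 = 2) : undo P p q r t ∈ Phi1 n d m :=
  ⟨_, ((h.edgesWithMult_undo_le hP.2.1 hp).trans hP.2.2.le).trans hi,
    numLoops_eq_zero (h.mult_undo_self (mult_self_eq_zero hP.1)),
    fun _ _ huv => h.mult_undo_le_two hP.2.1 huv, rfl⟩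

theorem isTypeIB_undo (h : Reversible P p q r t)
    (hs : mult P p.1 (P.f p).1 + mult P q.1 (P.f q).1 + mult P r.1 (P.f r).1 +
      mult P t.1 (P.f t).1 = 5) :
    IsTypeIB (undo P p q r t) (switchTo P p q r t) := by
  have hp := h.mult_undo_target
  have hq := h.mult_undo_target_q
  have hr := h.mult_undo_target_r
  have ht := h.mult_undo_target_t
  have hj : joinedCount (undo P p q r t) (switchTo P p q r t) = 1 := by
    simp only [joinedCount, targets, switchTo, List.countP_cons, List.countP_nil,
      decide_eq_true_eq]
    grind
  refine ⟨⟨h.isDSwitch_undo, ?_, hj.le⟩, hj⟩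
  simp only [targets, switchTo, List.mem_cons, List.not_mem_nil, or_false, forall_eq_or_imp,
    forall_eq]
  omega

theorem undo_partner (h : Reversible P p q r t) {c : Point n d} (hc : c ≠ p) (hc1 : c.1 = p.1)
    (hc2 : (P.f c).1 = (P.f p).1) : (undo P p q r t).f c = P.f c := by
  refine undo_of_notMem P p q r t ?_
  have hb := h.bins
  simp only [List.pairwise_cons, List.mem_cons, List.not_mem_nil] at hb ⊢
  grind

end Reversible

/-- The d-switching `switchTo P a b x y` can be undone, and creates the double edge containing `a`
but none containing `x` or `y`. -/
structure Creates (P : Pairing n d) (a b x y : Point n d) : Prop extends Reversible P a b x y where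
  double : mult P a.1 (P.f a).1 = 2
  single : mult P x.1 (P.f x).1 = 1
  single' : mult P y.1 (P.f y).1 = 1

/-- The four ways of labelling the points of a d-switching by `a, b, x, y`. -/
def arrange (P : Pairing n d) (a b x y : Point n d) : Fin 4 → DSwitch n d
  | 0 => switchTo P a b x y
  | 1 => switchTo P b a y x
  | 2 => switchTo P x y a b
  | 3 => switchTo P y x b a

theorem dResult_arrange {P : Pairing n d} {a b x y : Point n d} (h : Reversible P a b x y)
    (k : Fin 4) : dResult (undo P a b x y) (arrange P a b x y k) = P := by
  fin_cases k
  · exact dResult_undo P a b x y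
  · exact h.undo_reverse ▸ dResult_undo P b a y x
  · exact h.undo_exchange ▸ dResult_undo P x y a b
  · exact h.undo_reverse ▸ h.reverse.undo_exchange ▸ dResult_undo P y x b a

theorem isTypeIB_arrange {P : Pairing n d} {a b x y : Point n d} (h : Creates P a b x y)
    (hb : mult P b.1 (P.f b).1 = 1) (k : Fin 4) :
    IsTypeIB (undo P a b x y) (arrange P a b x y k) := by
  have h1 := h.double
  have h2 := h.single
  have h3 := h.single'
  have hr := h.toReversible
  fin_cases k
  · exact hr.isTypeIB_undo (by omega)
  · exact hr.undo_reverse ▸ hr.reverse.isTypeIB_undo (by omega)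
  · exact hr.undo_exchange ▸ hr.exchange.isTypeIB_undo (by omega)
  · exact hr.undo_reverse ▸ hr.reverse.undo_exchange ▸ hr.reverse.exchange.isTypeIB_undo (by omega)

/-- `arrange` together with the points `9, 10, 11, 12` of a type II switching. -/
def arrange2 (P : Pairing n d) (π : Point n d → Point n d) (a b x y : Point n d) (k : Fin 4) :
    DSwitch2 n d :=
  ⟨arrange P a b x y k, π a, P.f (π a), P.f (π b), π b⟩

theorem isTypeII_arrange2 {P : Pairing n d} {π : Point n d → Point n d}
    (hπ : ∀ a, mult P a.1 (P.f a).1 = 2 → π a ≠ a ∧ (π a).1 = a.1 ∧ (P.f (π a)).1 = (P.f a).1)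
    {a b x y : Point n d} (h : Creates P a b x y) (hb : mult P b.1 (P.f b).1 = 2) (k : Fin 4) :
    IsTypeII (undo P a b x y) (arrange2 P π a b x y k) := by
  have hr := h.toReversible
  obtain ⟨ha1, ha2, ha3⟩ := hπ a h.double
  obtain ⟨hb1, hb2, hb3⟩ := hπ b hb
  have hfa := hr.undo_partner ha1 ha2 ha3
  have hfb := Pairing.f_eq_comm _ (hr.undo_reverse ▸ hr.reverse.undo_partner hb1 hb2 hb3)
  have h1 := h.double
  have h2 := h.single
  have h3 := h.single'
  have hp := hr.mult_undo_target
  have hq := hr.mult_undo_target_q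
  have hx := hr.mult_undo_target_r
  have hy := hr.mult_undo_target_t
  have e1 := h.fst_eq
  have e2 := h.fst_eq'
  have hD : IsDSwitch (undo P a b x y) (arrange P a b x y k) := by
    fin_cases k
    · exact hr.isDSwitch_undo
    · exact hr.undo_reverse ▸ hr.reverse.isDSwitch_undo
    · exact hr.undo_exchange ▸ hr.exchange.isDSwitch_undo
    · exact hr.undo_reverse ▸ hr.reverse.undo_exchange ▸ hr.reverse.exchange.isDSwitch_undo
  refine ⟨hD, ?_, hfa, hfb, ?_⟩
  · fin_cases k <;>
      simp only [targets, arrange2, arrange, switchTo, List.mem_cons, List.not_mem_nil, or_false,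
        forall_eq_or_imp, forall_eq, ← e1, ← e2] <;>
      omega
  · fin_cases k <;> simp only [arrange2, arrange, switchTo, ha2, ha3, hb2, hb3, ← e1, ← e2]
    · exact Or.inl ⟨trivial, trivial, Or.inl ⟨trivial, trivial⟩, by omega⟩
    · exact Or.inl ⟨trivial, trivial, Or.inr ⟨trivial, trivial⟩, by omega⟩
    · exact Or.inr ⟨trivial, trivial, Or.inl ⟨trivial, trivial⟩, by omega⟩
    · exact Or.inr ⟨trivial, trivial, Or.inr ⟨trivial, trivial⟩, by omega⟩

theorem arrange_injective {P : Pairing n d} {a b x y a' b' x' y' : Point n d} {k k' : Fin 4}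
    (h : Creates P a b x y) (hb : mult P b.1 (P.f b).1 = 1)
    (h' : Creates P a' b' x' y') (hb' : mult P b'.1 (P.f b').1 = 1)
    (he : arrange P a b x y k = arrange P a' b' x' y' k') :
    k = k' ∧ (a, b, x, y) = (a', b', x', y') := by
  have h1 := h.double
  have h2 := h.single
  have h3 := h.single'
  have h1' := h'.double
  have h2' := h'.single
  have h3' := h'.single'
  fin_cases k <;> fin_cases k' <;>
    simp only [arrange, switchTo, DSwitch.mk.injEq] at he <;>
    obtain ⟨rfl, rfl, rfl, rfl, -⟩ := he <;> first | exact ⟨rfl, rfl⟩ | omega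

theorem arrange2_injective {P : Pairing n d} {π : Point n d → Point n d}
    (hπ : ∀ a, mult P a.1 (P.f a).1 = 2 → π a ≠ a ∧ (π a).1 = a.1 ∧ (P.f (π a)).1 = (P.f a).1)
    {a b x y a' b' x' y' : Point n d} {k k' : Fin 4}
    (h : Creates P a b x y) (h' : Creates P a' b' x' y')
    (he : arrange2 P π a b x y k = arrange2 P π a' b' x' y' k') :
    k = k' ∧ (a, b, x, y) = (a', b', x', y') := by
  have h1 := h.double
  have h2 := h.single
  have h3 := h.single'
  have h1' := h'.double
  have h2' := h'.single
  have h3' := h'.single'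
  have hc := (hπ a h1).2.2
  have hc' := (hπ a' h1').2.2
  have hn := h.bins
  simp only [List.pairwise_cons, List.mem_cons, List.not_mem_nil] at hn
  rw [arrange2, arrange2, DSwitch2.mk.injEq] at he
  obtain ⟨he, -, hg, -, -⟩ := he
  rw [hg] at hc
  fin_cases k <;> fin_cases k' <;>
    simp only [arrange, switchTo, DSwitch.mk.injEq] at he <;>
    obtain ⟨rfl, rfl, rfl, rfl, -⟩ := he <;> first | exact ⟨rfl, rfl⟩ | omega | grind

instance : Finite (DSwitch n d) :=
  Finite.of_injective (fun s => (s.p1, s.p2, s.p3, s.p4, s.p5, s.p6, s.p7, s.p8)) fun s s' h => by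
    cases s; cases s'; simpa using h

instance : Finite (DSwitch2 n d) :=
  Finite.of_injective (fun s => (s.toDSwitch, s.p9, s.p10, s.p11, s.p12)) fun s s' h => by
    cases s; cases s'; simpa using h

open Classical in
/-- The quadruples `(a, b, x, y)` satisfying `Creates`. -/
noncomputable def creating (P : Pairing n d) :
    Finset (Point n d × Point n d × Point n d × Point n d) :=
  Finset.univ.filter fun z => Creates P z.1 z.2.1 z.2.2.1 z.2.2.2

theorem mem_creating {P : Pairing n d} {z : Point n d × Point n d × Point n d × Point n d} :
    z ∈ creating P ↔ Creates P z.1 z.2.1 z.2.2.1 z.2.2.2 := by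
  simp [creating]

/-- Each creating quadruple accounts for four class B switchings. -/
theorem four_mul_card_creating_le {P : Pairing n d} {i m : ℕ} (hi : i ≤ m) (hP : P ∈ SD n d i) :
    4 * (creating P).card ≤ bB m P := by
  choose! π hπ using exists_partner P
  let sgl (z : Point n d × Point n d × Point n d × Point n d) : Prop :=
    mult P z.2.1.1 (P.f z.2.1).1 = 1
  have hI : Nat.card (Fin 4 × {z // z ∈ (creating P).filter sgl}) ≤
      Nat.card {q : Pairing n d × DSwitch n d //
        q.1 ∈ Phi1 n d m ∧ IsTypeIB q.1 q.2 ∧ dResult q.1 q.2 = P} := by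
    have hz (w : {z // z ∈ (creating P).filter sgl}) :
        Creates P w.1.1 w.1.2.1 w.1.2.2.1 w.1.2.2.2 ∧ sgl w :=
      ⟨mem_creating.1 (Finset.mem_filter.1 w.2).1, (Finset.mem_filter.1 w.2).2⟩
    refine Nat.card_le_card_of_injective (fun w =>
      ⟨(undo P w.2.1.1 w.2.1.2.1 w.2.1.2.2.1 w.2.1.2.2.2,
        arrange P w.2.1.1 w.2.1.2.1 w.2.1.2.2.1 w.2.1.2.2.2 w.1),
        (hz w.2).1.undo_mem_Phi1 hi hP (hz w.2).1.double,
        isTypeIB_arrange (hz w.2).1 (hz w.2).2 w.1,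
        dResult_arrange (hz w.2).1.toReversible w.1⟩) fun w w' he => ?_
    have := arrange_injective (hz w.2).1 (hz w.2).2 (hz w'.2).1 (hz w'.2).2
      (congrArg (fun s => s.1.2) he)
    exact Prod.ext this.1 (Subtype.ext this.2)
  have hII : Nat.card (Fin 4 × {z // z ∈ (creating P).filter fun z => ¬sgl z}) ≤
      Nat.card {q : Pairing n d × DSwitch2 n d //
        q.1 ∈ Phi1 n d m ∧ IsTypeII q.1 q.2 ∧ dResult q.1 q.2.toDSwitch = P} := by
    have hz (w : {z // z ∈ (creating P).filter fun z => ¬sgl z}) :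
        Creates P w.1.1 w.1.2.1 w.1.2.2.1 w.1.2.2.2 ∧
          mult P w.1.2.1.1 (P.f w.1.2.1).1 = 2 := by
      have h1 := (Finset.mem_filter.1 w.2).2
      have h2 := one_le_mult P w.1.2.1
      have h3 := hP.2.1 _ _ (bin_ne (mult_self_eq_zero hP.1) w.1.2.1)
      exact ⟨mem_creating.1 (Finset.mem_filter.1 w.2).1, by simp only [sgl] at h1; omega⟩
    refine Nat.card_le_card_of_injective (fun w =>
      ⟨(undo P w.2.1.1 w.2.1.2.1 w.2.1.2.2.1 w.2.1.2.2.2,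
        arrange2 P π w.2.1.1 w.2.1.2.1 w.2.1.2.2.1 w.2.1.2.2.2 w.1),
        (hz w.2).1.undo_mem_Phi1 hi hP (hz w.2).1.double,
        isTypeII_arrange2 hπ (hz w.2).1 (hz w.2).2 w.1,
        dResult_arrange (hz w.2).1.toReversible w.1⟩) fun w w' he => ?_
    have := arrange2_injective hπ (hz w.2).1 (hz w'.2).1 (congrArg (fun s => s.1.2) he)
    exact Prod.ext this.1 (Subtype.ext this.2)
  rw [Nat.card_prod, Nat.card_fin, Nat.card_eq_fintype_card, Fintype.card_coe] at hI hII
  rw [bB, ← Finset.card_filter_add_card_filter_not (s := creating P) sgl, mul_add]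
  exact add_le_add hI hII

theorem card_points_in_bins (U : Finset (Fin n)) :
    (Finset.univ.filter fun x : Point n d => x.1 ∈ U).card = U.card * d := by
  have : (Finset.univ.filter fun x : Point n d => x.1 ∈ U) = U ×ˢ Finset.univ := by
    ext x; simp
  rw [this, Finset.card_product, Finset.card_univ, Fintype.card_fin]

theorem card_points_in_bin (u : Fin n) :
    (Finset.univ.filter fun x : Point n d => x.1 = u).card = d := by
  simpa using card_points_in_bins (d := d) {u}

theorem card_filter_f (P : Pairing n d) (p : Point n d → Prop) [DecidablePred p] :
    (Finset.univ.filter fun x => p (P.f x)).card = (Finset.univ.filter p).card := by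
  refine Finset.card_bij (fun x _ => P.f x) ?_ ?_ ?_
  · simp
  · intro x _ y _ h
    simpa [P.invol] using congrArg P.f h
  · intro y hy
    exact ⟨P.f y, by simpa [P.invol] using hy, P.invol y⟩

/-- The points lying in the bins adjacent to a given bin. -/
theorem card_points_adjacent_le (P : Pairing n d) (u : Fin n) :
    (Finset.univ.filter fun x : Point n d => mult P u x.1 ≠ 0).card ≤ d * d := by
  have hsub : (Finset.univ.filter fun x : Point n d => mult P u x.1 ≠ 0) ⊆
      (Finset.univ.filter fun a : Point n d => a.1 = u).biUnion fun a =>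
        Finset.univ.filter fun x : Point n d => x.1 = (P.f a).1 := by
    intro x hx
    obtain ⟨a, ha⟩ := Finset.card_pos.1 (Nat.pos_of_ne_zero (Finset.mem_filter.1 hx).2)
    simp only [Finset.mem_filter, Finset.mem_univ, true_and] at ha
    simp only [Finset.mem_biUnion, Finset.mem_filter, Finset.mem_univ, true_and]
    exact ⟨a, ha.1, ha.2.symm⟩
  calc _ ≤ _ := Finset.card_le_card hsub
    _ ≤ _ := Finset.card_biUnion_le_card_mul _ _ d fun a _ => (card_points_in_bin _).le
    _ = d * d := by rw [card_points_in_bin]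

/-- There are four points in each double edge. -/
theorem card_double_points {P : Pairing n d} (h0 : ∀ u, mult P u u = 0) :
    (Finset.univ.filter fun a => mult P a.1 (P.f a).1 = 2).card = 4 * edgesWithMult P 2 := by
  rw [edgesWithMult, mul_comm, Finset.card_eq_sum_card_fiberwise
    (f := fun a => sortBins a.1 (P.f a).1)
    (t := Finset.univ.filter fun z : Fin n × Fin n => z.1 < z.2 ∧ mult P z.1 z.2 = 2)]
  · refine Finset.sum_const_nat fun z hz => ?_
    obtain ⟨hz1, hz2⟩ := (Finset.mem_filter.1 hz).2
    have hunion : ((Finset.univ.filter fun a => mult P a.1 (P.f a).1 = 2).filter fun a =>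
        sortBins a.1 (P.f a).1 = z) =
        (Finset.univ.filter fun a : Point n d => a.1 = z.1 ∧ (P.f a).1 = z.2) ∪
          Finset.univ.filter fun a : Point n d => a.1 = z.2 ∧ (P.f a).1 = z.1 := by
      ext a
      simp only [Finset.mem_filter, Finset.mem_univ, true_and, Finset.mem_union]
      constructor
      · rintro ⟨-, rfl⟩
        rcases le_total a.1 (P.f a).1 with h | h <;> simp [sortBins, h]
      · rintro (⟨h1, h2⟩ | ⟨h1, h2⟩)
        · exact ⟨by rw [h1, h2, hz2], sortBins_eq_of_lt hz1 (Or.inl ⟨h1, h2⟩)⟩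
        · exact ⟨by rw [h1, h2, mult_comm, hz2], sortBins_eq_of_lt hz1 (Or.inr ⟨h2, h1⟩)⟩
    rw [hunion, Finset.card_union_of_disjoint, ← mult, ← mult, mult_comm P z.2, hz2]
    refine Finset.disjoint_left.2 fun a ha hb => hz1.ne ?_
    rw [← (Finset.mem_filter.1 ha).2.1, ← (Finset.mem_filter.1 hb).2.1]
  · intro a ha
    have ha' : mult P a.1 (P.f a).1 = 2 := by simpa using ha
    simp only [Finset.coe_filter, Finset.mem_univ, true_and, Set.mem_ofPred_eq]
    exact ⟨sortBins_lt (bin_ne h0 a), by rw [mult_sortBins, ha']⟩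

theorem card_filter_prod {α β : Type*} [Fintype α] [Fintype β] (R : α → β → Prop)
    [∀ a b, Decidable (R a b)] :
    (Finset.univ.filter fun z : α × β => R z.1 z.2).card =
      ∑ a, (Finset.univ.filter fun b => R a b).card := by
  simp only [Finset.card_filter, Fintype.sum_prod_type]

theorem card_other_points (x : Point n d) :
    (Finset.univ.filter fun y : Point n d => x.1 = y.1 ∧ x ≠ y).card = d - 1 := by
  have : (Finset.univ.filter fun y : Point n d => x.1 = y.1 ∧ x ≠ y) =
      (Finset.univ.filter fun y : Point n d => y.1 = x.1).erase x := by
    ext y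
    simp only [Finset.mem_filter, Finset.mem_univ, true_and, Finset.mem_erase]
    grind
  rw [this, Finset.card_erase_of_mem (by simp), card_points_in_bin]

theorem card_paths_fst (S : Finset (Point n d)) :
    (Finset.univ.filter fun z : Point n d × Point n d =>
      z.1 ∈ S ∧ z.1.1 = z.2.1 ∧ z.1 ≠ z.2).card = S.card * (d - 1) := by
  rw [card_filter_prod fun x y : Point n d => x ∈ S ∧ x.1 = y.1 ∧ x ≠ y]
  have (x : Point n d) : (Finset.univ.filter fun y : Point n d =>
      x ∈ S ∧ x.1 = y.1 ∧ x ≠ y).card = if x ∈ S then d - 1 else 0 := by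
    split_ifs with h
    · simp only [h, true_and, card_other_points]
    · simp [h]
  simp only [this, Finset.sum_ite_mem, Finset.univ_inter, Finset.sum_const, smul_eq_mul]

theorem card_paths_snd (S : Finset (Point n d)) :
    (Finset.univ.filter fun z : Point n d × Point n d =>
      z.2 ∈ S ∧ z.1.1 = z.2.1 ∧ z.1 ≠ z.2).card = S.card * (d - 1) := by
  rw [← card_paths_fst S]
  refine Finset.card_bij (fun z _ => z.swap) ?_ ?_ ?_
  · intro z hz
    simp only [Finset.mem_filter, Finset.mem_univ, true_and, Prod.fst_swap, Prod.snd_swap] at hz ⊢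
    exact ⟨hz.1, hz.2.1.symm, hz.2.2.symm⟩
  · exact fun z _ z' _ h => Prod.swap_injective h
  · intro z hz
    simp only [Finset.mem_filter, Finset.mem_univ, true_and] at hz
    exact ⟨z.swap, by simpa using ⟨hz.1, hz.2.1.symm, hz.2.2.symm⟩, Prod.swap_swap z⟩

open Classical in
/-- For given `a` and `b`, all but a bounded number of choices of `x` and `y` create a
double edge. -/
theorem card_paths_le {P : Pairing n d} {i : ℕ} (hP : P ∈ SD n d i) {a b : Point n d}
    (ha : mult P a.1 (P.f a).1 = 2) (hab : b.1 = a.1) (hne : (P.f b).1 ≠ (P.f a).1) :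
    n * d * (d - 1) ≤
      (Finset.univ.filter fun z : Point n d × Point n d => Creates P a b z.1 z.2).card +
        (d - 1) * (8 * i + 9 * d + 3 * d * d) := by
  have h0 := mult_self_eq_zero hP.1
  have hone (x : Point n d) (hx : ¬mult P x.1 (P.f x).1 = 2) : mult P x.1 (P.f x).1 = 1 := by
    have h1 := one_le_mult P x
    have h2 := hP.2.1 _ _ (bin_ne h0 x)
    omega
  set D := Finset.univ.filter fun x : Point n d => mult P x.1 (P.f x).1 = 2 with hD
  have hDc : D.card = 4 * i := by rw [hD, card_double_points h0, hP.2.2]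
  let U : Finset (Fin n) := {a.1, (P.f a).1, (P.f b).1}
  have hU : U.card * d ≤ 3 * d := Nat.mul_le_mul_right d Finset.card_le_three
  set B := Finset.univ.filter fun x : Point n d => x.1 ∈ U with hB
  have hBc : B.card ≤ 3 * d := (card_points_in_bins U).trans_le hU
  set B' := Finset.univ.filter fun x : Point n d => (P.f x).1 ∈ U with hB'
  have hBc' : B'.card ≤ 3 * d := (card_filter_f P fun x => x.1 ∈ U).trans_le hBc
  set A := Finset.univ.filter fun x : Point n d => mult P a.1 x.1 ≠ 0 with hA
  have hAc : A.card ≤ d * d := card_points_adjacent_le P a.1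
  set A' := fun w : Point n d =>
    Finset.univ.filter fun x : Point n d => mult P (P.f w).1 (P.f x).1 ≠ 0 with hA'
  have hAc' (w : Point n d) : (A' w).card ≤ d * d :=
    (card_filter_f P fun x => mult P (P.f w).1 x.1 ≠ 0).trans_le (card_points_adjacent_le P _)
  set X := D ∪ B ∪ B' ∪ A ∪ A' a with hX
  set Y := D ∪ B' ∪ A' b with hY
  have hXc : X.card ≤ 4 * i + 6 * d + 2 * (d * d) := by
    rw [hX]
    have := Finset.card_union_le (D ∪ B ∪ B' ∪ A) (A' a)
    have := Finset.card_union_le (D ∪ B ∪ B') A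
    have := Finset.card_union_le (D ∪ B) B'
    have := Finset.card_union_le D B
    have := hAc' a
    omega
  have hYc : Y.card ≤ 4 * i + 3 * d + d * d := by
    rw [hY]
    have := Finset.card_union_le (D ∪ B') (A' b)
    have := Finset.card_union_le D B'
    have := hAc' b
    omega
  have hcover : (Finset.univ.filter fun z : Point n d × Point n d =>
      z.1 ∈ Finset.univ ∧ z.1.1 = z.2.1 ∧ z.1 ≠ z.2) ⊆
      (Finset.univ.filter fun z : Point n d × Point n d => Creates P a b z.1 z.2) ∪
        ((Finset.univ.filter fun z : Point n d × Point n d =>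
            z.1 ∈ X ∧ z.1.1 = z.2.1 ∧ z.1 ≠ z.2) ∪
          Finset.univ.filter fun z : Point n d × Point n d =>
            z.2 ∈ Y ∧ z.1.1 = z.2.1 ∧ z.1 ≠ z.2) := by
    rintro ⟨x, y⟩ hz
    simp only [Finset.mem_filter, Finset.mem_univ, true_and, Finset.mem_union] at hz ⊢
    obtain ⟨hxy, hxy'⟩ := hz
    by_cases hx : x ∈ X
    · exact Or.inr (Or.inl ⟨hx, hxy, hxy'⟩)
    by_cases hy : y ∈ Y
    · exact Or.inr (Or.inr ⟨hy, hxy, hxy'⟩)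
    left
    simp only [hX, hY, hD, hB, hB', hA, hA', U, Finset.mem_union, Finset.mem_filter,
      Finset.mem_univ, true_and, Finset.mem_insert, Finset.mem_singleton, not_or, ne_eq,
      not_not] at hx hy
    obtain ⟨⟨⟨⟨hx1, hx2, hx3, hx4⟩, hx5, hx6, hx7⟩, hx8⟩, hx9⟩ := hx
    obtain ⟨⟨hy1, hy2, hy3, hy4⟩, hy5⟩ := hy
    have hx10 := hone x hx1
    have hy10 := hone y hy1
    have hxy2 : (P.f x).1 ≠ (P.f y).1 := by
      intro he
      have hlt : 1 < mult P x.1 (P.f x).1 :=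
        Finset.one_lt_card.2 ⟨x, by simp, y, by simp [hxy, he], hxy'⟩
      omega
    refine ⟨⟨hab.symm, hxy, ?_, hx8, hx9, hy5⟩, ha, hx10, hy10⟩
    have h1 := bin_ne h0 a
    have h2 := bin_ne h0 b
    have h3 := bin_ne h0 x
    have h4 := bin_ne h0 y
    simp only [List.pairwise_cons, List.mem_cons, List.not_mem_nil]
    refine ⟨?_, ?_, ?_, ?_, ?_, ?_, ?_⟩ <;> grind
  have hcard := (Finset.card_le_card hcover).trans ((Finset.card_union_le _ _).trans
    (Nat.add_le_add_left (Finset.card_union_le _ _) _))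
  rw [card_paths_fst, card_paths_fst, card_paths_snd, Finset.card_univ, Fintype.card_prod,
    Fintype.card_fin, Fintype.card_fin] at hcard
  refine hcard.trans (Nat.add_le_add_left ?_ _)
  rw [← add_mul, mul_comm]
  exact Nat.mul_le_mul_left _ (by linarith)

theorem card_creating_ge {P : Pairing n d} {i : ℕ} (hP : P ∈ SD n d i) :
    4 * i * (d - 2) * (n * d * (d - 1)) ≤
      (creating P).card + 4 * i * (d - 2) * ((d - 1) * (8 * i + 9 * d + 3 * d * d)) := by
  classical
  have h0 := mult_self_eq_zero hP.1
  set D := Finset.univ.filter fun x : Point n d => mult P x.1 (P.f x).1 = 2 with hD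
  have hDc : D.card = 4 * i := by rw [hD, card_double_points h0, hP.2.2]
  let E (a : Point n d) := Finset.univ.filter fun b : Point n d =>
    b.1 = a.1 ∧ ¬(P.f b).1 = (P.f a).1
  have hE (a : Point n d) (ha : a ∈ D) : (E a).card = d - 2 := by
    have h1 := Finset.card_filter_add_card_filter_not
      (s := Finset.univ.filter fun b : Point n d => b.1 = a.1) fun b => (P.f b).1 = (P.f a).1
    rw [Finset.filter_filter, Finset.filter_filter, card_points_in_bin, ← mult,
      (Finset.mem_filter.1 ha).2] at h1
    simp only [E]
    omega
  let g (a b : Point n d) :=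
    (Finset.univ.filter fun z : Point n d × Point n d => Creates P a b z.1 z.2).card
  have hg : (creating P).card = ∑ a, ∑ b, g a b := by
    have h1 := card_filter_prod fun (a : Point n d) (w : Point n d × Point n d × Point n d) =>
      Creates P a w.1 w.2.1 w.2.2
    have h2 (a : Point n d) := card_filter_prod fun (b : Point n d) (w : Point n d × Point n d) =>
      Creates P a b w.1 w.2
    simp only [h2] at h1
    rw [← h1, creating]
  have hle : ∑ a ∈ D, ∑ b ∈ E a, g a b ≤ (creating P).card := by
    rw [hg]
    exact (Finset.sum_le_sum fun a _ => Finset.sum_le_sum_of_subset (Finset.subset_univ _)).trans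
      (Finset.sum_le_sum_of_subset (Finset.subset_univ _))
  have hconst (c : ℕ) : ∑ a ∈ D, ∑ _b ∈ E a, c = 4 * i * (d - 2) * c := by
    rw [← hDc, mul_assoc]
    refine Finset.sum_const_nat fun a ha => ?_
    rw [Finset.sum_const, hE a ha, smul_eq_mul]
  rw [← hconst, ← hconst]
  refine le_trans ?_ (Nat.add_le_add_right hle _)
  simp only [← Finset.sum_add_distrib]
  refine Finset.sum_le_sum fun a ha => Finset.sum_le_sum fun b hb => ?_
  obtain ⟨hb1, hb2⟩ := (Finset.mem_filter.1 hb).2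
  exact card_paths_le hP (Finset.mem_filter.1 ha).2 hb1 hb2

theorem two_le_of_mem_SD {P : Pairing n d} {i : ℕ} (hP : P ∈ SD n d i) (hi : i ≠ 0) : 2 ≤ d := by
  have hi' := hP.2.2 ▸ hi
  obtain ⟨z, hz⟩ := Finset.card_pos.1 (Nat.pos_of_ne_zero hi')
  have h1 : mult P z.1 z.2 = 2 := (Finset.mem_filter.1 hz).2.2
  have h2 : mult P z.1 z.2 ≤ d :=
    (Finset.card_le_card (Finset.monotone_filter_right _ fun _ _ h => h.1)).trans
      (card_points_in_bin (d := d) z.1).le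
  omega

/-- For every `0 ≤ i ≤ i1` and every pairing `P ∈ S_i`, the number of class B
switchings producing `P` satisfies
`b_B(P) ≥ 16 i (d-2) M2 - 16 i d (8 i d + 9 d² + 3 d³)`. -/
theorem stmt_3 (n d : ℕ) (hn : 0 < n) (hd : 0 < d) (he : Even (d * n))
    (γ : ℝ) (hγ : 0 < γ) (i : ℕ) (hi : i ≤ i1Nat d γ)
    (P : Pairing n d) (hP : P ∈ SD n d i) :
    16 * i * ((d : ℝ) - 2) * M2R n d
        - 16 * i * (d : ℝ) * (8 * i * d + 9 * (d : ℝ) ^ 2 + 3 * (d : ℝ) ^ 3)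
      ≤ (bB (i1Nat d γ) P : ℝ) := by
  rcases Nat.eq_zero_or_pos i with rfl | hi0
  · simp
  obtain ⟨e, rfl⟩ := Nat.exists_eq_add_of_le (two_le_of_mem_SD hP hi0.ne')
  have h1 := card_creating_ge hP
  have h2 := four_mul_card_creating_le hi hP
  rw [show 2 + e - 1 = e + 1 by omega, show 2 + e - 2 = e by omega] at h1
  have h3 : 4 * (4 * i * e * (n * (2 + e) * (e + 1))) ≤ bB (i1Nat (2 + e) γ) P +
      4 * (4 * i * e * ((e + 1) * (8 * i + 9 * (2 + e) + 3 * (2 + e) * (2 + e)))) := by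
    linarith
  have h4 : e * (e + 1) * (8 * i + 9 * (2 + e) + 3 * (2 + e) * (2 + e)) ≤
      (2 + e) * (2 + e) * (8 * i + 9 * (2 + e) + 3 * (2 + e) * (2 + e)) :=
    Nat.mul_le_mul_right _ (Nat.mul_le_mul (by omega) (by omega))
  have h5 := Nat.mul_le_mul_left (16 * i) h4
  have h6 : 4 * (4 * i * e * (n * (2 + e) * (e + 1))) ≤ bB (i1Nat (2 + e) γ) P +
      16 * i * ((2 + e) * (2 + e) * (8 * i + 9 * (2 + e) + 3 * (2 + e) * (2 + e))) := by
    linarith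
  have h7 : ((4 * (4 * i * e * (n * (2 + e) * (e + 1))) : ℕ) : ℝ) ≤
      ((bB (i1Nat (2 + e) γ) P + 16 * i * ((2 + e) * (2 + e) *
        (8 * i + 9 * (2 + e) + 3 * (2 + e) * (2 + e))) : ℕ) : ℝ) := by
    exact_mod_cast h6
  push_cast at h7
  rw [M2R]
  push_cast
  linarith

end Reg
end
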